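/- Let π be a dominant integral weight and let v ≤ w be π-minuscule elements in W^π. Then H(v) is canonically identified with an order filter of H(w) (via a final subexpression of a reduced expression of w), H(w v^{−1}) = H(w) \ H(v), and the map z ↦ H(z) \ H(v) is a poset isomorphism from the Bruhat interval [v,w]^π onto the set F(H(w) \ H(v)) of order filters of H(w) \ H(v), ordered by inclusion. -/

import Mathlib

open scoped Classical BigOperators

/-- A bundled setting for a finite crystallographic root system together with its
Weyl group, its action on the rational span of the weight lattice, reflections,
and the data of coefficients of roots in the basis of simple roots. -/
structure WeylSetting where
  /-- index set of the Dynkin diagram (simple roots) -/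
  I : Type
  [fintypeI : Fintype I]
  [decEqI : DecidableEq I]
  /-- rational span of the weight lattice -/
  V : Type
  [acg : AddCommGroup V]
  [mod : Module ℚ V]
  /-- the Weyl group -/
  W : Type
  [grp : Group W]
  /-- the action of the Weyl group on weights -/
  act : W →* (V ≃ₗ[ℚ] V)
  /-- the simple roots -/
  simple : I → V
  /-- the (finite) set of roots -/
  roots : Finset V
  /-- `coroot β μ` is the pairing `⟨μ, β∨⟩` -/
  coroot : V → (V →ₗ[ℚ] ℚ)
  /-- the reflection `s_β ∈ W` associated to a root `β` -/
  srefl : V → W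
  /-- coefficients of a positive root in the basis of simple roots -/
  posCoeff : V → I → ℕ
  simple_mem : ∀ i, simple i ∈ roots
  simple_indep : LinearIndependent ℚ simple
  roots_neg : ∀ β ∈ roots, -β ∈ roots
  root_pos_or_neg : ∀ β ∈ roots,
    (∃ c : I → ℚ, (∀ i, 0 ≤ c i) ∧ β = ∑ i, c i • simple i) ∨
    (∃ c : I → ℚ, (∀ i, 0 ≤ c i) ∧ -β = ∑ i, c i • simple i)
  coroot_self : ∀ β ∈ roots, coroot β β = 2
  crystallographic : ∀ β ∈ roots, ∀ γ ∈ roots, ∃ n : ℤ, coroot β γ = n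
  posCoeff_spec : ∀ β ∈ roots,
    (∃ c : I → ℚ, (∀ i, 0 ≤ c i) ∧ β = ∑ i, c i • simple i) →
    β = ∑ i, (posCoeff β i : ℚ) • simple i
  srefl_apply : ∀ β ∈ roots, ∀ v : V, act (srefl β) v = v - coroot β v • β
  act_faithful : ∀ g : W, (∀ v : V, act g v = v) → g = 1
  roots_invariant : ∀ g : W, ∀ β ∈ roots, act g β ∈ roots
  coroot_equivariant : ∀ g : W, ∀ β ∈ roots, ∀ v : V,
    coroot (act g β) (act g v) = coroot β v
  generated : ∀ g : W, ∃ l : List I, g = (l.map fun i => srefl (simple i)).prod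

namespace WeylSetting

attribute [instance] fintypeI decEqI acg mod grp

variable (D : WeylSetting)

/-- the simple reflection attached to a node of the Dynkin diagram -/
def s (i : D.I) : D.W := D.srefl (D.simple i)

/-- the product `s_{i_1} ⋯ s_{i_r}` of the simple reflections listed in `l` -/
def wordProd (l : List D.I) : D.W := (l.map D.s).prod

/-- `β` is a positive root: a root which is a nonnegative combination of simple roots -/
def IsPosRoot (β : D.V) : Prop :=
  β ∈ D.roots ∧ ∃ c : D.I → ℚ, (∀ i, 0 ≤ c i) ∧ β = ∑ i, c i • D.simple i

/-- the length of a Weyl group element -/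
noncomputable def length (g : D.W) : ℕ :=
  sInf {n | ∃ l : List D.I, l.length = n ∧ D.wordProd l = g}

/-- `l` is a reduced word for `g` -/
def IsReduced (l : List D.I) (g : D.W) : Prop :=
  D.wordProd l = g ∧ l.length = D.length g

/-- the number of reduced words of `g` -/
noncomputable def RedCard (g : D.W) : ℕ := Nat.card {l : List D.I // D.IsReduced l g}

/-- the (strong) Bruhat order on the Weyl group -/
def bruhatLE : D.W → D.W → Prop :=
  Relation.ReflTransGen
    (fun a b => (∃ β, D.IsPosRoot β ∧ b = D.srefl β * a) ∧ D.length a < D.length b)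

/-- strict (strong) Bruhat order -/
def bruhatLT (a b : D.W) : Prop := D.bruhatLE a b ∧ a ≠ b

/-- the left weak Bruhat order: `a ≤_L b` iff `ℓ(b a⁻¹) + ℓ(a) = ℓ(b)` -/
def weakLE (a b : D.W) : Prop := D.length (b * a⁻¹) + D.length a = D.length b

/-- the height of a positive root: the sum of its coefficients in the simple roots -/
noncomputable def ht (β : D.V) : ℕ := ∑ i, D.posCoeff β i

/-- an integral weight: the pairings with all positive coroots are integers -/
def IsIntegral (lam : D.V) : Prop :=
  ∀ β, D.IsPosRoot β → ∃ n : ℤ, D.coroot β lam = n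

/-- a dominant integral weight -/
def IsDominant (lam : D.V) : Prop :=
  D.IsIntegral lam ∧ ∀ i, 0 ≤ D.coroot (D.simple i) lam

/-- a pre-dominant integral weight: `⟨λ, β∨⟩ ≥ -1` for all positive roots `β` -/
def IsPreDominant (lam : D.V) : Prop :=
  D.IsIntegral lam ∧ ∀ β, D.IsPosRoot β → -1 ≤ D.coroot β lam

/-- the diagram `D(λ) = {β ∈ R⁺ : ⟨λ, β∨⟩ = -1}` of a pre-dominant weight -/
noncomputable def diagram (lam : D.V) : Finset D.V :=
  D.roots.filter fun β => D.IsPosRoot β ∧ D.coroot β lam = -1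

/-- `IsWeightPath λ [β₁, …, β_r]` says that
`λ = λ₀ →β₁ λ₁ →β₂ ⋯ →β_r λ_r` is a `λ`-path, i.e. each `β_j` is a positive
root, `⟨λ_{j-1}, β_j∨⟩ = -1` and `λ_j = s_{β_j}(λ_{j-1})`. -/
def IsWeightPath : D.V → List D.V → Prop
  | _, [] => True
  | lam, β :: rest =>
      D.IsPosRoot β ∧ D.coroot β lam = -1 ∧
        IsWeightPath (D.act (D.srefl β) lam) rest

/-- the term `1/β₁ ⋅ 1/(β₁+β₂) ⋅ … ⋅ 1/(β₁+⋯+β_r)` attached to a path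
`(β₁, …, β_r)`, computed in a field `F` via a linear embedding `emb`. -/
noncomputable def pathTerm {F : Type} [Field F] [Algebra ℚ F]
    (emb : D.V →ₗ[ℚ] F) (l : List D.V) : F :=
  ∏ j ∈ Finset.range l.length, (emb ((l.take (j + 1)).sum))⁻¹

/-- `w` is a π-minuscule element (in the sense of Peterson). -/
def IsMinuscule (pi : D.V) (w : D.W) : Prop :=
  ∃ l : List D.I, D.IsReduced l w ∧
    ∀ k : Fin l.length,
      D.coroot (D.simple (l.get k)) (D.act (D.wordProd (l.drop (k.val + 1))) pi) = 1

/-- the stabilizer `W_π = Stab_W(π)` of a weight -/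
def stab (pi : D.V) : Subgroup D.W where
  carrier := {g | D.act g pi = pi}
  one_mem' := by simp
  mul_mem' := by
    intro a b ha hb
    simp only [Set.mem_setOf_eq] at *
    calc D.act (a * b) pi = D.act a (D.act b pi) := by rw [map_mul]; rfl
    _ = pi := by rw [hb, ha]
  inv_mem' := by
    intro a ha
    simp only [Set.mem_setOf_eq] at *
    calc D.act a⁻¹ pi = D.act a⁻¹ (D.act a pi) := by rw [ha]
    _ = D.act (a⁻¹ * a) pi := by rw [map_mul]; rfl
    _ = pi := by simp

/-- `u` is the minimal-length representative of its coset `uH` -/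
def IsMinRep (H : Subgroup D.W) (u : D.W) : Prop :=
  ∀ g : D.W, u⁻¹ * g ∈ H → D.length u ≤ D.length g

/-- `a` and `b` lie in the same coset of `H`, i.e. `aH = bH` -/
def SameCoset (H : Subgroup D.W) (a b : D.W) : Prop := a⁻¹ * b ∈ H

/-- `u →β w` in `W^P`: `β` is a positive root, `u, w` are minimal-length
representatives, `s_β w H = u H`, and `u < w` in Bruhat order -/
def Arrow (H : Subgroup D.W) (u w : D.W) (β : D.V) : Prop :=
  D.IsPosRoot β ∧ D.IsMinRep H u ∧ D.IsMinRep H w ∧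
    D.SameCoset H (D.srefl β * w) u ∧ D.bruhatLT u w

/-- `ArrowPath H w [β₁, …, β_r]` encodes a directed path
`x_r →β_r ⋯ → x_1 →β₁ x_0 = w` in the Bruhat graph on `W^P`. -/
def ArrowPath (H : Subgroup D.W) : D.W → List D.V → Prop
  | _, [] => True
  | w, β :: rest => ∃ u, D.Arrow H u w β ∧ ArrowPath H u rest

/-- directed paths as above whose vertices all lie above `v` in Bruhat order -/
def ArrowPathGE (H : Subgroup D.W) (v : D.W) : D.W → List D.V → Prop
  | _, [] => True
  | w, β :: rest => ∃ u, D.Arrow H u w β ∧ D.bruhatLE v u ∧ ArrowPathGE H v u rest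

/-- directed paths from `u` to `w`:
`u = x_r →β_r ⋯ → x_1 →β₁ x_0 = w` encoded by the list `[β₁, …, β_r]`. -/
def ArrowPathFromTo (H : Subgroup D.W) (u : D.W) : D.W → List D.V → Prop
  | w, [] => u = w
  | w, β :: rest => ∃ x, D.Arrow H x w β ∧ ArrowPathFromTo H u x rest

/-- `S(w) = {β ∈ R⁺ : s_β w < w}` -/
noncomputable def Sset (w : D.W) : Finset D.V :=
  D.roots.filter fun β => D.IsPosRoot β ∧ D.bruhatLT (D.srefl β * w) w

/-- `S(w/v) = {β ∈ R⁺ : v ≤ s_β w < w}` -/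
noncomputable def SsetSkew (v w : D.W) : Finset D.V :=
  D.roots.filter fun β =>
    D.IsPosRoot β ∧ D.bruhatLE v (D.srefl β * w) ∧ D.bruhatLT (D.srefl β * w) w

/-- an oriented edge `x → y` in the Bruhat graph of `G/P`: `x, y` are minimal
representatives, `xH < yH`, and `yH = x s_γ H` for some positive root `γ` -/
def GEdge (H : Subgroup D.W) (x y : D.W) : Prop :=
  D.IsMinRep H x ∧ D.IsMinRep H y ∧ D.bruhatLT x y ∧
    ∃ γ, D.IsPosRoot γ ∧ D.SameCoset H (x * D.srefl γ) y

/-- the (unique) positive root `γ` with `yH = x s_γ H` attached to an edge -/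
noncomputable def edgeRoot (H : Subgroup D.W) (x y : D.W) : D.V :=
  if h : ∃ γ, D.IsPosRoot γ ∧ D.SameCoset H (x * D.srefl γ) y then h.choose else 0

/-- `GChainTo H v t [x₁, …, x_r]` encodes a directed path
`v ≤ x_r → ⋯ → x_1 → x_0 = t` in the Bruhat graph of `G/P` -/
def GChainTo (H : Subgroup D.W) (v : D.W) : D.W → List D.W → Prop
  | _, [] => True
  | t, x :: rest => D.GEdge H x t ∧ D.bruhatLE v x ∧ GChainTo H v x rest

/-- the weighted term
`(m_Λ(x_r,x_{r-1})/W_Λ(x_r)) ⋯ (m_Λ(x_1,x_0)/W_Λ(x_1))` of a path in the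
`Λ`-Bruhat graph, computed in a field `F` via a linear embedding `emb`. -/
noncomputable def chainTerm {F : Type} [Field F] [Algebra ℚ F]
    (emb : D.V →ₗ[ℚ] F) (H : Subgroup D.W) (Lam : D.W → D.V) (w : D.W) :
    D.W → List D.W → F
  | _, [] => 1
  | t, x :: rest =>
      algebraMap ℚ F (D.coroot (D.edgeRoot H x t) (Lam x)) *
        (emb (D.act x (Lam x) - D.act w (Lam x)))⁻¹ *
        chainTerm emb H Lam w x rest

/-- the Bruhat order on cosets: `aH ≤ bH` -/
def cosetLE (H : Subgroup D.W) (a b : D.W) : Prop :=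
  ∃ x y, D.SameCoset H a x ∧ D.SameCoset H b y ∧ D.bruhatLE x y

/-- the (standard) parabolic subgroup generated by simple reflections in `J` -/
def parab (J : Set D.I) : Subgroup D.W := Subgroup.closure (D.s '' J)

/-- `X*(T)_P`: integral weights orthogonal to all coroots of `W_P`,
i.e. to `γ∨` for all positive roots `γ` in the span of the simple roots of `P` -/
def OrthWeightP (J : Set D.I) (lam : D.V) : Prop :=
  D.IsIntegral lam ∧
    ∀ γ, D.IsPosRoot γ → γ ∈ Submodule.span ℚ (D.simple '' J) → D.coroot γ lam = 0

/-- an admissible function `Λ : [v,w]^P → X*(T)_P` -/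
def Admissible (J : Set D.I) (v w : D.W) (Lam : D.W → D.V) : Prop :=
  (∀ x, D.IsMinRep (D.parab J) x → D.bruhatLE v x → D.bruhatLE x w →
      D.OrthWeightP J (Lam x)) ∧
  (∀ x, D.IsMinRep (D.parab J) x → D.bruhatLE v x → D.bruhatLE x w → x ≠ w →
      D.act x (Lam x) ≠ D.act w (Lam x))

/-- the subword of `l` with letters at the positions in `S`, in increasing order -/
def subwordF (l : List D.I) (S : Finset (Fin l.length)) : List D.I :=
  ((List.finRange l.length).filter fun j => j ∈ S).map l.get

/-- `β_j = s_{i_1} ⋯ s_{i_{j-1}}(α_{i_j})` attached to a reduced word `l` -/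
noncomputable def refRoot (l : List D.I) (j : Fin l.length) : D.V :=
  D.act (D.wordProd (l.take j.val)) (D.simple (l.get j))

/-- the Weyl group is simply laced: the Cartan pairing is symmetric -/
def SimplyLaced : Prop :=
  ∀ i j, D.coroot (D.simple i) (D.simple j) = D.coroot (D.simple j) (D.simple i)

/-- generating relation of the heap order of the word `l`:
`p_j < p_k` whenever `j < k` and `s_{i_j}`, `s_{i_k}` do not commute -/
def heapCovers (l : List D.I) (j k : Fin l.length) : Prop :=
  (j : ℕ) < (k : ℕ) ∧ D.s (l.get j) * D.s (l.get k) ≠ D.s (l.get k) * D.s (l.get j)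

/-- the heap order of the word `l`: the minimal partial order generated by
`heapCovers` -/
def heapLE (l : List D.I) : Fin l.length → Fin l.length → Prop :=
  Relation.ReflTransGen (D.heapCovers l)

/-- strict heap order -/
def heapLT (l : List D.I) (j k : Fin l.length) : Prop := D.heapLE l j k ∧ j ≠ k

/-- `F` is an order filter of the heap `H(w)` of the word `l` -/
def IsHeapFilter (l : List D.I) (F : Finset (Fin l.length)) : Prop :=
  ∀ j k, j ∈ F → D.heapLE l j k → k ∈ F

/-- `i` and `j` are joined by an edge of the Dynkin diagram -/
def adjDynkin (i j : D.I) : Prop := i ≠ j ∧ D.s i * D.s j ≠ D.s j * D.s i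

/-- an elementary excitation `A ▷ B` of subsets of the heap of the word `l` -/
def Excite (l : List D.I) (A B : Finset (Fin l.length)) : Prop :=
  ∃ p q, D.heapLT l p q ∧ l.get p = l.get q ∧ q ∈ A ∧ p ∈ B ∧
    A.erase q = B.erase p ∧
    (∀ z, D.heapLT l p z → D.heapLT l z q → l.get z ≠ l.get p) ∧
    ∀ u ∈ A, D.heapLE l p u → D.heapLE l u q → ¬ D.adjDynkin (l.get p) (l.get u)

/-- `A` is an excited diagram of `F` in the heap of the word `l`,
i.e. `A ∈ E_{H(w)}(F)` -/
def InExcited (l : List D.I) (F A : Finset (Fin l.length)) : Prop :=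
  Relation.ReflTransGen (D.Excite l) F A

end WeylSetting

namespace WeylSetting

variable (D : WeylSetting)

theorem act_mul (a b : D.W) (x : D.V) : D.act (a * b) x = D.act a (D.act b x) := by
  rw [map_mul]; rfl

theorem act_one (x : D.V) : D.act 1 x = x := by
  rw [map_one]; rfl

theorem act_inv_act (a : D.W) (x : D.V) : D.act a⁻¹ (D.act a x) = x := by
  rw [← act_mul, inv_mul_cancel, act_one]

theorem act_act_inv (a : D.W) (x : D.V) : D.act a (D.act a⁻¹ x) = x := by
  rw [← act_mul, mul_inv_cancel, act_one]

theorem act_inj {a b : D.W} (h : ∀ x, D.act a x = D.act b x) : a = b := by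
  have : b⁻¹ * a = 1 := D.act_faithful _ fun x => by rw [act_mul, h, act_inv_act]
  exact (inv_mul_eq_one.mp this).symm

theorem exists_coord : ∃ f : D.I → (D.V →ₗ[ℚ] ℚ),
    ∀ i j, f i (D.simple j) = if j = i then 1 else 0 := by
  obtain ⟨g, hg⟩ := LinearMap.exists_leftInverse_of_injective
    (Finsupp.linearCombination ℚ D.simple) (LinearMap.ker_eq_bot.mpr D.simple_indep)
  refine ⟨fun i => (Finsupp.lapply i).comp g, fun i j => ?_⟩
  have := LinearMap.congr_fun hg (Finsupp.single j 1)
  simp only [LinearMap.comp_apply, Finsupp.linearCombination_single, one_smul,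
    LinearMap.id_apply] at this
  simp [this, Finsupp.single_apply]

noncomputable def co : D.I → (D.V →ₗ[ℚ] ℚ) := D.exists_coord.choose

theorem co_simple (i j : D.I) : D.co i (D.simple j) = if j = i then 1 else 0 :=
  D.exists_coord.choose_spec i j

theorem co_sum (c : D.I → ℚ) (i : D.I) : D.co i (∑ j, c j • D.simple j) = c i := by
  simp [map_sum, co_simple]

theorem root_ne_zero {β : D.V} (h : β ∈ D.roots) : β ≠ 0 := by
  intro h0
  have := D.coroot_self β h
  rw [h0, map_zero] at this
  norm_num at this

theorem pos_co {β : D.V} (h : D.IsPosRoot β) (i : D.I) : 0 ≤ D.co i β := by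
  obtain ⟨_, c, hc, e⟩ := h
  rw [e, co_sum]; exact hc i

theorem pos_sum {β : D.V} (h : D.IsPosRoot β) : β = ∑ i, D.co i β • D.simple i := by
  obtain ⟨_, c, hc, e⟩ := h
  conv_lhs => rw [e]
  refine Finset.sum_congr rfl fun i _ => ?_
  rw [e, co_sum]

theorem pos_or_neg {β : D.V} (h : β ∈ D.roots) : D.IsPosRoot β ∨ D.IsPosRoot (-β) := by
  rcases D.root_pos_or_neg β h with h' | h'
  · exact Or.inl ⟨h, h'⟩
  · exact Or.inr ⟨D.roots_neg β h, h'⟩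

theorem pos_not_neg {β : D.V} (h : D.IsPosRoot β) (h' : D.IsPosRoot (-β)) : False := by
  apply D.root_ne_zero h.1
  rw [D.pos_sum h]
  refine Finset.sum_eq_zero fun i _ => ?_
  have h1 := D.pos_co h i
  have h2 := D.pos_co h' i
  rw [map_neg] at h2
  rw [le_antisymm (by linarith) h1, zero_smul]

theorem simple_pos (i : D.I) : D.IsPosRoot (D.simple i) :=
  ⟨D.simple_mem i, fun j => if j = i then 1 else 0, fun j => by dsimp only; split_ifs <;> norm_num,
    by simp⟩

/-- invariant form -/
noncomputable def B (x y : D.V) : ℚ := ∑ γ ∈ D.roots, D.coroot γ x * D.coroot γ y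

theorem B_comm (x y : D.V) : D.B x y = D.B y x :=
  Finset.sum_congr rfl fun _ _ => mul_comm _ _

theorem B_inv (g : D.W) (x y : D.V) : D.B (D.act g x) (D.act g y) = D.B x y := by
  unfold B
  symm
  refine Finset.sum_bij (fun γ _ => D.act g γ) (fun γ h => D.roots_invariant g γ h)
    (fun a _ b _ h => (D.act g).injective h)
    (fun b hb => ⟨D.act g⁻¹ b, D.roots_invariant _ b hb, D.act_act_inv g b⟩) ?_
  intro γ h
  rw [D.coroot_equivariant g γ h, D.coroot_equivariant g γ h]

theorem B_sub_left (x y z : D.V) : D.B (x - y) z = D.B x z - D.B y z := by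
  simp [B, sub_mul, Finset.sum_sub_distrib]

theorem B_smul_left (c : ℚ) (y z : D.V) : D.B (c • y) z = c * D.B y z := by
  simp [B, Finset.mul_sum, mul_assoc]

theorem B_sum_left (c : D.I → ℚ) (z : D.V) :
    D.B (∑ j, c j • D.simple j) z = ∑ j, c j * D.B (D.simple j) z := by
  simp only [B, map_sum, map_smul, smul_eq_mul, Finset.sum_mul, Finset.mul_sum]
  rw [Finset.sum_comm]
  simp [mul_assoc]

theorem B_self_pos {β : D.V} (h : β ∈ D.roots) : 0 < D.B β β := by
  refine Finset.sum_pos' (fun γ _ => mul_self_nonneg _) ⟨β, h, ?_⟩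
  rw [D.coroot_self β h]; norm_num

theorem srefl_self {β : D.V} (h : β ∈ D.roots) : D.act (D.srefl β) β = -β := by
  rw [D.srefl_apply β h, D.coroot_self β h, two_smul]; abel

theorem coroot_B {β : D.V} (h : β ∈ D.roots) (x : D.V) :
    D.coroot β x * D.B β β = 2 * D.B β x := by
  have h1 := D.B_inv (D.srefl β) x β
  rw [D.srefl_self h, D.srefl_apply β h, B_sub_left, B_smul_left, D.B_comm x (-β),
    D.B_comm β (-β)] at h1
  rw [show -β = (-1 : ℚ) • β by simp, B_smul_left, B_smul_left, D.B_comm x β] at h1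
  linarith

theorem srefl_sq {β : D.V} (h : β ∈ D.roots) : D.srefl β * D.srefl β = 1 := by
  apply D.act_faithful
  intro x
  rw [act_mul, D.srefl_apply β h x, map_sub, map_smul, D.srefl_self h, D.srefl_apply β h]
  simp

theorem s_sq (i : D.I) : D.s i * D.s i = 1 := D.srefl_sq (D.simple_mem i)

theorem s_inv (i : D.I) : (D.s i)⁻¹ = D.s i := inv_eq_of_mul_eq_one_left (D.s_sq i)

theorem srefl_inv {β : D.V} (h : β ∈ D.roots) : (D.srefl β)⁻¹ = D.srefl β :=
  inv_eq_of_mul_eq_one_left (D.srefl_sq h)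

theorem s_mul_s_mul (i : D.I) (g : D.W) : D.s i * (D.s i * g) = g := by
  rw [← mul_assoc, s_sq, one_mul]

theorem s_apply (i : D.I) (x : D.V) :
    D.act (D.s i) x = x - D.coroot (D.simple i) x • D.simple i :=
  D.srefl_apply _ (D.simple_mem i) x

theorem srefl_conj (g : D.W) {β : D.V} (h : β ∈ D.roots) :
    D.srefl (D.act g β) = g * D.srefl β * g⁻¹ := by
  apply D.act_inj
  intro x
  have h2 := D.coroot_equivariant g β h (D.act g⁻¹ x)
  rw [act_act_inv] at h2
  rw [D.srefl_apply _ (D.roots_invariant g β h), act_mul, act_mul, D.srefl_apply β h,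
    map_sub, act_act_inv, map_smul, h2]

/-- scaling -/
theorem coroot_smul {β γ : D.V} (h : β ∈ D.roots) (h' : γ ∈ D.roots) (c : ℚ)
    (e : γ = c • β) (x : D.V) : c * D.coroot γ x = D.coroot β x := by
  have h1 := D.coroot_B h x
  have h2 := D.coroot_B h' x
  have hb := D.B_self_pos h
  have hg := D.B_self_pos h'
  have hc : c ≠ 0 := by
    rintro rfl; exact D.root_ne_zero h' (by simpa using e)
  rw [e, B_smul_left, D.B_comm β (c • β), B_smul_left, B_smul_left, ← e] at h2
  have : c * (D.B β β) * (c * D.coroot γ x - D.coroot β x) = 0 := by linear_combination h2 - c * h1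
  rcases mul_eq_zero.mp this with h | h
  · rcases mul_eq_zero.mp h with h | h
    · exact absurd h hc
    · exact absurd h hb.ne'
  · linarith

theorem srefl_smul {β γ : D.V} (h : β ∈ D.roots) (h' : γ ∈ D.roots) (c : ℚ)
    (e : γ = c • β) : D.srefl γ = D.srefl β := by
  apply D.act_inj
  intro x
  rw [D.srefl_apply _ h, D.srefl_apply _ h', ← D.coroot_smul h h' c e x, e, smul_smul, mul_comm]

/-- simple reflections almost preserve positivity -/
theorem pos_s (i : D.I) {β : D.V} (h : D.IsPosRoot β) :
    D.IsPosRoot (D.act (D.s i) β) ∨ β = D.co i β • D.simple i := by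
  rcases D.pos_or_neg (D.roots_invariant (D.s i) β h.1) with h' | h'
  · exact Or.inl h'
  · right
    conv_lhs => rw [D.pos_sum h]
    refine Finset.sum_eq_single i (fun k _ hk => ?_) (by simp)
    have h1 := D.pos_co h k
    have h2 := D.pos_co h' k
    rw [s_apply, map_neg, map_sub, map_smul, co_simple, if_neg (Ne.symm hk)] at h2
    simp only [smul_zero, sub_zero] at h2
    rw [le_antisymm (by linarith) h1, zero_smul]

theorem co_nat {β : D.V} (h : D.IsPosRoot β) (i : D.I) : ∃ n : ℕ, D.co i β = n := by
  have := D.posCoeff_spec β h.1 h.2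
  exact ⟨D.posCoeff β i, by conv_lhs => rw [this, co_sum]⟩

/-- a positive root, conjugate to a simple root, proportional to a simple root is simple -/
theorem orbit_simple (g : D.W) (i k : D.I) (c : ℚ) (hp : D.IsPosRoot (D.act g (D.simple k)))
    (e : D.act g (D.simple k) = c • D.simple i) : D.act g (D.simple k) = D.simple i := by
  obtain ⟨n, hn⟩ := D.co_nat hp i
  rw [e, map_smul, co_simple, if_pos rfl, smul_eq_mul, mul_one] at hn
  have hc : c ≠ 0 := by
    rintro rfl; exact D.root_ne_zero hp.1 (by simpa using e)
  have hcpos : 0 < c := lt_of_le_of_ne (hn ▸ Nat.cast_nonneg n) hc.symm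
  have e2 : D.act g⁻¹ (D.simple i) = c⁻¹ • D.simple k := by
    have h := congrArg (D.act g⁻¹) e
    rw [act_inv_act, map_smul] at h
    rw [h, smul_smul, inv_mul_cancel₀ hc, one_smul]
  have hr : c⁻¹ • D.simple k ∈ D.roots := e2 ▸ D.roots_invariant _ _ (D.simple_mem i)
  have hp2 : D.IsPosRoot (c⁻¹ • D.simple k) := by
    rcases D.pos_or_neg hr with h | h
    · exact h
    · have := D.pos_co h k
      rw [map_neg, map_smul, co_simple, if_pos rfl, smul_eq_mul, mul_one] at this
      have := inv_pos.mpr hcpos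
      linarith
  obtain ⟨m, hm⟩ := D.co_nat hp2 k
  rw [map_smul, co_simple, if_pos rfl, smul_eq_mul, mul_one] at hm
  have h1 : (n : ℚ) * m = 1 := by rw [← hn, ← hm, mul_inv_cancel₀ hc]
  have h2 : n * m = 1 := by exact_mod_cast h1
  have h3 : n = 1 := Nat.eq_one_of_mul_eq_one_right h2
  rw [e, hn, h3]; simp

theorem coroot_dominant {pi : D.V} (hpi : D.IsDominant pi) {β : D.V} (h : D.IsPosRoot β) :
    0 ≤ D.coroot β pi := by
  have h1 := D.coroot_B h.1 pi
  have hb := D.B_self_pos h.1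
  have h2 : 0 ≤ D.B β pi := by
    rw [D.pos_sum h, B_sum_left]
    refine Finset.sum_nonneg fun i _ => mul_nonneg (D.pos_co h i) ?_
    have h3 := D.coroot_B (D.simple_mem i) pi
    have h4 := D.B_self_pos (D.simple_mem i)
    have := mul_nonneg (hpi.2 i) h4.le
    linarith
  by_contra hn
  push Not at hn
  have := mul_neg_of_neg_of_pos hn hb
  linarith

/-- commuting simple reflections -/
def Comm (i j : D.I) : Prop := D.s i * D.s j = D.s j * D.s i

theorem comm_coroot {i j : D.I} (hij : j ≠ i) (h : D.Comm i j) :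
    D.coroot (D.simple i) (D.simple j) = 0 := by
  have h1 : D.act (D.s j) (D.act (D.s i) (D.simple j)) = - D.act (D.s i) (D.simple j) := by
    rw [← act_mul, ← show _ = _ from h, act_mul]
    rw [show D.act (D.s j) (D.simple j) = - D.simple j from D.srefl_self (D.simple_mem j), map_neg]
  have h2 := congrArg (D.co i) h1
  rw [s_apply, s_apply] at h2
  simp [co_simple, hij] at h2
  linarith

theorem noncomm_coroot {i j : D.I} (h : ¬ D.Comm i j) :
    D.coroot (D.simple i) (D.simple j) ≤ -1 := by
  have hij : j ≠ i := by rintro rfl; exact h rfl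
  have hle : D.coroot (D.simple i) (D.simple j) ≤ 0 := by
    rcases D.pos_s i (D.simple_pos j) with h1 | h1
    · have := D.pos_co h1 i
      rw [s_apply] at this
      simp [co_simple, hij] at this
      linarith
    · have := congrArg (D.co j) h1
      simp [co_simple, hij] at this
  have hne : D.coroot (D.simple i) (D.simple j) ≠ 0 := by
    intro h0
    apply h
    have h1 := D.coroot_B (D.simple_mem i) (D.simple j)
    have h2 := D.coroot_B (D.simple_mem j) (D.simple i)
    rw [h0, zero_mul] at h1
    rw [D.B_comm (D.simple j) (D.simple i), ← h1] at h2
    have h3 : D.coroot (D.simple j) (D.simple i) = 0 := by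
      rcases mul_eq_zero.mp h2 with h | h
      · exact h
      · exact absurd h (D.B_self_pos (D.simple_mem j)).ne'
    apply D.act_inj
    intro x
    simp only [act_mul, s_apply, map_sub, map_smul, h0, h3, smul_zero, zero_smul, sub_zero]
    abel
  obtain ⟨n, hn⟩ := D.crystallographic _ (D.simple_mem i) _ (D.simple_mem j)
  rw [hn] at hle hne ⊢
  have a1 : n ≤ 0 := by exact_mod_cast hle
  have a2 : n ≠ 0 := by exact_mod_cast hne
  have : n ≤ -1 := by omega
  exact_mod_cast this


theorem wordProd_nil : D.wordProd [] = 1 := rfl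

theorem wordProd_cons (i : D.I) (l : List D.I) : D.wordProd (i :: l) = D.s i * D.wordProd l := by
  simp [wordProd]

theorem wordProd_append (a b : List D.I) :
    D.wordProd (a ++ b) = D.wordProd a * D.wordProd b := by
  simp [wordProd]

theorem exists_word (g : D.W) : ∃ l, D.wordProd l = g ∧ l.length = D.length g := by
  have hne : {n | ∃ l : List D.I, l.length = n ∧ D.wordProd l = g}.Nonempty := by
    obtain ⟨l, hl⟩ := D.generated g
    exact ⟨l.length, l, rfl, hl.symm⟩
  obtain ⟨l, h1, h2⟩ := Nat.sInf_mem hne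
  exact ⟨l, h2, h1⟩

theorem length_le (l : List D.I) : D.length (D.wordProd l) ≤ l.length :=
  Nat.sInf_le ⟨l, rfl, rfl⟩

theorem length_mul_le (a b : D.W) : D.length (a * b) ≤ D.length a + D.length b := by
  obtain ⟨l, h1, h2⟩ := D.exists_word a
  obtain ⟨m, h3, h4⟩ := D.exists_word b
  have := D.length_le (l ++ m)
  rw [wordProd_append, h1, h3, List.length_append] at this
  omega

theorem length_s_mul_le (i : D.I) (b : D.W) : D.length (D.s i * b) ≤ 1 + D.length b := by
  have h := D.length_le [i]
  rw [wordProd_cons, wordProd_nil, mul_one] at h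
  have := D.length_mul_le (D.s i) b
  simp at h
  omega

theorem exchange (l : List D.I) : ∀ β, D.IsPosRoot β →
    D.IsPosRoot (-(D.act (D.wordProd l)⁻¹ β)) →
    ∃ m, m.Sublist l ∧ m.length + 1 = l.length ∧ D.wordProd m = D.srefl β * D.wordProd l := by
  induction l with
  | nil =>
    intro β h h'
    rw [wordProd_nil, inv_one, act_one] at h'
    exact (D.pos_not_neg h h').elim
  | cons i l ih =>
    intro β h h'
    rcases D.pos_s i h with h1 | h1
    · rw [wordProd_cons, mul_inv_rev, s_inv, act_mul] at h'
      obtain ⟨m, hm, hlen, e⟩ := ih _ h1 h'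
      refine ⟨i :: m, hm.cons_cons i, by simp [hlen], ?_⟩
      rw [D.srefl_conj _ h.1, s_inv] at e
      rw [wordProd_cons, wordProd_cons, e, mul_assoc, mul_assoc, s_mul_s_mul]
    · refine ⟨l, List.sublist_cons_self i l, by simp, ?_⟩
      rw [D.srefl_smul (D.simple_mem i) h.1 _ h1, wordProd_cons]
      exact (D.s_mul_s_mul i _).symm

theorem length_lt_of_neg {β : D.V} (h : D.IsPosRoot β) (g : D.W)
    (h' : D.IsPosRoot (-(D.act g⁻¹ β))) : D.length (D.srefl β * g) < D.length g := by
  obtain ⟨l, rfl, hl⟩ := D.exists_word g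
  obtain ⟨m, _, h2, h3⟩ := D.exchange l β h h'
  rw [← h3, ← hl, ← h2]
  exact Nat.lt_succ_of_le (D.length_le m)

theorem length_lt_of_pos {β : D.V} (h : D.IsPosRoot β) (g : D.W)
    (h' : D.IsPosRoot (D.act g⁻¹ β)) : D.length g < D.length (D.srefl β * g) := by
  have := D.length_lt_of_neg h (D.srefl β * g) (by
    rw [mul_inv_rev, D.srefl_inv h.1, act_mul, D.srefl_self h.1, map_neg, neg_neg]; exact h')
  rwa [← mul_assoc, D.srefl_sq h.1, one_mul] at this

theorem neg_of_length_lt {β : D.V} (h : D.IsPosRoot β) (g : D.W)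
    (hl : D.length (D.srefl β * g) < D.length g) : D.IsPosRoot (-(D.act g⁻¹ β)) := by
  rcases D.pos_or_neg (D.roots_invariant g⁻¹ β h.1) with h' | h'
  · have := D.length_lt_of_pos h g h'; omega
  · exact h'

theorem pos_of_length_lt {β : D.V} (h : D.IsPosRoot β) (g : D.W)
    (hl : D.length g < D.length (D.srefl β * g)) : D.IsPosRoot (D.act g⁻¹ β) := by
  rcases D.pos_or_neg (D.roots_invariant g⁻¹ β h.1) with h' | h'
  · exact h'
  · have := D.length_lt_of_neg h g h'; omega

/-- Bruhat below a word means subword -/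
theorem bruhat_sublist {z w : D.W} (h : D.bruhatLE z w) (l : List D.I) (hl : D.wordProd l = w) :
    ∃ m, m.Sublist l ∧ D.wordProd m = z := by
  induction h using Relation.ReflTransGen.head_induction_on with
  | refl => exact ⟨l, List.Sublist.refl l, hl⟩
  | @head a b hab _ ih =>
    obtain ⟨⟨β, hβ, e⟩, hlen⟩ := hab
    obtain ⟨m, hm, rfl⟩ := ih
    have ea : D.srefl β * D.wordProd m = a := by
      rw [e, ← mul_assoc, D.srefl_sq hβ.1, one_mul]
    obtain ⟨m', h1, _, h3⟩ := D.exchange m β hβ (D.neg_of_length_lt hβ _ (by rw [ea]; exact hlen))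
    exact ⟨m', h1.trans hm, h3.trans ea⟩

/-- reducedness of a word -/
def Red (l : List D.I) : Prop := D.length (D.wordProd l) = l.length

theorem red_append {a b : List D.I} (h : D.Red (a ++ b)) : D.Red a ∧ D.Red b := by
  unfold Red at *
  rw [wordProd_append, List.length_append] at h
  have h1 := D.length_mul_le (D.wordProd a) (D.wordProd b)
  have h2 := D.length_le a
  have h3 := D.length_le b
  omega

theorem red_tail {i : D.I} {b : List D.I} (h : D.Red (i :: b)) : D.Red b :=
  (D.red_append (a := [i]) h).2

theorem weak_bruhat (u m : List D.I) (h : D.Red (u ++ m)) :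
    D.bruhatLE (D.wordProd m) (D.wordProd (u ++ m)) := by
  induction u with
  | nil => exact Relation.ReflTransGen.refl
  | cons i u ih =>
    have h' := D.red_tail h
    refine (ih h').tail ⟨⟨D.simple i, D.simple_pos i, ?_⟩, ?_⟩
    · rw [List.cons_append, wordProd_cons]; rfl
    · unfold Red at h h'
      rw [List.cons_append] at h ⊢
      have h2 : D.length (D.wordProd (u ++ m)) = (u ++ m).length := h'
      rw [h, h2]; simp
end WeylSetting

namespace WeylSetting

variable (D : WeylSetting)

/-- recursive form of the minuscule condition, with starting weight `x` -/
def Minu (x : D.V) : List D.I → Prop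
  | [] => True
  | i :: l => D.coroot (D.simple i) (D.act (D.wordProd l) x) = 1 ∧ Minu x l

theorem minu_of (x : D.V) (l : List D.I)
    (h : ∀ k : Fin l.length,
      D.coroot (D.simple (l.get k)) (D.act (D.wordProd (l.drop (k.val + 1))) x) = 1) :
    D.Minu x l := by
  induction l with
  | nil => trivial
  | cons i l ih => exact ⟨by simpa using h ⟨0, by simp⟩, ih fun k => by simpa using h k.succ⟩

theorem minu_append {x : D.V} {a b : List D.I} (h : D.Minu x (a ++ b)) :
    D.Minu x b ∧ D.Minu (D.act (D.wordProd b) x) a := by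
  induction a with
  | nil => exact ⟨h, trivial⟩
  | cons i a ih =>
    obtain ⟨h1, h2⟩ := h
    refine ⟨(ih h2).1, ?_, (ih h2).2⟩
    rw [← act_mul, ← wordProd_append]; exact h1

theorem minu_weight {x : D.V} {l : List D.I} (h : D.Minu x l) :
    D.act (D.wordProd l) x = x - (l.map D.simple).sum := by
  induction l with
  | nil => simp [wordProd_nil, act_one]
  | cons i l ih =>
    rw [wordProd_cons, act_mul, s_apply, h.1, ih h.2, List.map_cons, List.sum_cons, one_smul]
    abel

theorem co_list (l : List D.I) (i : D.I) : D.co i (l.map D.simple).sum = l.count i := by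
  induction l with
  | nil => simp
  | cons j l ih =>
    rw [List.map_cons, List.sum_cons, map_add, ih, co_simple, List.count_cons]
    by_cases hj : j = i <;> simp [hj, add_comm]

theorem minu_count {x : D.V} {l m : List D.I} (h : D.Minu x l) (h' : D.Minu x m)
    (e : D.wordProd l = D.wordProd m) (i : D.I) : l.count i = m.count i := by
  have h1 := D.minu_weight h
  rw [e, D.minu_weight h'] at h1
  have := congrArg (D.co i) h1
  rw [map_sub, map_sub, co_list, co_list] at this
  have h2 : (l.count i : ℚ) = m.count i := by linarith
  exact_mod_cast h2

/-- inversion form of the minuscule condition -/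
def Inv1 (x : D.V) (w : D.W) : Prop := ∀ g k, D.IsPosRoot (D.act g (D.simple k)) →
  D.IsPosRoot (-(D.act w (D.act g (D.simple k)))) → D.coroot (D.act g (D.simple k)) x = 1

theorem inv1_of_minu {x : D.V} (l : List D.I) (h : D.Minu x l) : D.Inv1 x (D.wordProd l) := by
  induction l with
  | nil =>
    intro g k h1 h2
    rw [wordProd_nil, act_one] at h2
    exact (D.pos_not_neg h1 h2).elim
  | cons i l ih =>
    intro g k h1 h2
    have hr : D.act g (D.simple k) ∈ D.roots := h1.1
    rcases D.pos_or_neg (D.roots_invariant (D.wordProd l) _ hr) with h3 | h3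
    · rw [wordProd_cons, act_mul] at h2
      rcases D.pos_s i h3 with h4 | h4
      · exact (D.pos_not_neg h4 h2).elim
      · rw [← act_mul] at h4 h3
        have h5 := D.orbit_simple _ i k _ h3 h4
        rw [← D.coroot_equivariant (D.wordProd l) _ hr, ← act_mul, h5]
        exact h.1
    · exact ih h.2 g k h1 h3

theorem inv1_tail {x : D.V} {i : D.I} {m : D.W} (h : D.Inv1 x (D.s i * m))
    (hl : D.length m < D.length (D.s i * m)) : D.Inv1 x m := by
  intro g k h1 h2
  have h3 := D.pos_of_length_lt (D.simple_pos i) m hl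
  refine h g k h1 ?_
  rcases D.pos_s i h2 with h4 | h4
  · rwa [map_neg, ← act_mul] at h4
  · exfalso
    have h5 := congrArg (D.act m⁻¹) h4
    rw [map_neg, act_inv_act, map_smul] at h5
    obtain ⟨j, hj⟩ : ∃ j, D.co j (D.act g (D.simple k)) ≠ 0 := by
      by_contra hc
      push Not at hc
      apply D.root_ne_zero h1.1
      rw [D.pos_sum h1]; simp [hc]
    have h6 := congrArg (D.co j) h5
    rw [map_neg, map_smul, smul_eq_mul] at h6
    have a1 := D.pos_co h1 j
    have a2 := mul_nonneg (D.pos_co h2 i) (D.pos_co h3 j)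
    exact hj (by linarith)

theorem minu_of_inv1 {x : D.V} (l : List D.I) (hr : D.Red l) (h : D.Inv1 x (D.wordProd l)) :
    D.Minu x l := by
  induction l with
  | nil => trivial
  | cons i l ih =>
    have hr' := D.red_tail hr
    have hl : D.length (D.wordProd l) < D.length (D.s i * D.wordProd l) := by
      unfold Red at hr hr'
      rw [← wordProd_cons, hr, hr']; simp
    have h3 := D.pos_of_length_lt (D.simple_pos i) _ hl
    rw [wordProd_cons] at h
    refine ⟨?_, ih hr' (D.inv1_tail h hl)⟩
    have := h _ i h3 (by
      rw [act_mul, act_act_inv, show D.act (D.s i) (D.simple i) = - D.simple i from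
        D.srefl_self (D.simple_mem i), neg_neg]
      exact D.simple_pos i)
    rw [← D.coroot_equivariant (D.wordProd l) _ h3.1, act_act_inv] at this
    exact this

theorem minu_of_minu {x : D.V} {l m : List D.I} (h : D.Minu x l)
    (e : D.wordProd m = D.wordProd l) (hr : D.Red m) : D.Minu x m :=
  D.minu_of_inv1 m hr (e ▸ D.inv1_of_minu l h)


theorem prod_split {α G : Type} [Group G] (f : α → G) (P : α → Prop) [DecidablePred P]
    (L : List α) (h : L.Pairwise fun a b => P a → ¬ P b → f a * f b = f b * f a) :
    (L.map f).prod = ((L.filter fun a => ¬ P a).map f).prod * ((L.filter fun a => P a).map f).prod := by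
  induction L with
  | nil => simp
  | cons a L ih =>
    rw [List.pairwise_cons] at h
    have ih := ih h.2
    by_cases ha : P a
    · have hc : Commute (f a) ((L.filter fun a => ¬ P a).map f).prod := by
        apply Commute.list_prod_right
        intro y hy
        obtain ⟨b, hb, rfl⟩ := List.mem_map.mp hy
        rw [List.mem_filter] at hb
        exact h.1 b hb.1 ha (by simpa using hb.2)
      rw [List.filter_cons_of_neg (by simpa using ha), List.filter_cons_of_pos (by simpa using ha),
        List.map_cons, List.map_cons, List.prod_cons, List.prod_cons, ih, ← mul_assoc, ← mul_assoc,
        hc.eq]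
    · rw [List.filter_cons_of_pos (by simpa using ha), List.filter_cons_of_neg (by simpa using ha),
        List.map_cons, List.map_cons, List.prod_cons, List.prod_cons, ih, ← mul_assoc]

/-- positions in `S` listed increasingly -/
def pos (l : List D.I) (S : Finset (Fin l.length)) : List (Fin l.length) :=
  (List.finRange l.length).filter fun j => j ∈ S

theorem subwordF_eq (l : List D.I) (S : Finset (Fin l.length)) :
    D.subwordF l S = (D.pos l S).map l.get := by
  unfold subwordF pos; congr

theorem mem_pos (l : List D.I) (S : Finset (Fin l.length)) (j : Fin l.length) :
    j ∈ D.pos l S ↔ j ∈ S := by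
  simp [pos]

theorem pos_sorted (l : List D.I) (S : Finset (Fin l.length)) :
    (D.pos l S).Pairwise (· < ·) :=
  (List.pairwise_lt_finRange _).filter _

theorem pos_length (l : List D.I) (S : Finset (Fin l.length)) : (D.pos l S).length = S.card := by
  have hn : (D.pos l S).Nodup := (List.nodup_finRange _).filter _
  rw [← List.toFinset_card_of_nodup hn]
  congr 1
  ext j; simp [mem_pos]

theorem subwordF_length (l : List D.I) (S : Finset (Fin l.length)) :
    (D.subwordF l S).length = S.card := by
  rw [subwordF_eq, List.length_map, pos_length]

theorem subwordF_count (l : List D.I) (S : Finset (Fin l.length)) (i : D.I) :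
    (D.subwordF l S).count i = (S.filter fun j => l.get j = i).card := by
  rw [subwordF_eq, ← pos_length, List.count, List.countP_map, List.countP_eq_length_filter]
  unfold pos
  rw [List.filter_filter]
  congr 2
  ext j
  rw [Bool.eq_iff_iff]
  simp [and_comm]

theorem subwordF_univ (l : List D.I) : D.subwordF l Finset.univ = l := by
  simp [subwordF]

theorem wordProd_sub (l : List D.I) (S : Finset (Fin l.length)) :
    D.wordProd (D.subwordF l S) = ((D.pos l S).map fun j => D.s (l.get j)).prod := by
  rw [subwordF_eq, wordProd, List.map_map]; rfl

/-- filters through covers -/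
def IsF (l : List D.I) (F : Finset (Fin l.length)) : Prop :=
  ∀ j k, j < k → j ∈ F → ¬ D.Comm (l.get j) (l.get k) → k ∈ F

theorem isF_iff (l : List D.I) (F : Finset (Fin l.length)) : D.IsHeapFilter l F ↔ D.IsF l F := by
  constructor
  · intro h j k hjk hj hc
    exact h j k hj (Relation.ReflTransGen.single ⟨hjk, hc⟩)
  · intro h j k hj hjk
    induction hjk with
    | refl => exact hj
    | tail _ hbc ih => exact h _ _ hbc.1 ih hbc.2

theorem sub_split (l : List D.I) {F F' : Finset (Fin l.length)} (hF : D.IsF l F) (hs : F ⊆ F') :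
    D.wordProd (D.subwordF l F') =
      D.wordProd (D.subwordF l (F' \ F)) * D.wordProd (D.subwordF l F) := by
  rw [wordProd_sub, wordProd_sub, wordProd_sub, prod_split _ (fun j => j ∈ F)]
  · unfold pos
    rw [List.filter_filter, List.filter_filter]
    congr 4
    · ext j; simp [and_comm]
    · ext j; simp; exact fun h => hs h
  · refine (D.pos_sorted l F').imp ?_
    intro a b hab ha hb
    by_contra hc
    exact hb (hF a b hab ha hc)

theorem red_sub_aux (l : List D.I) {F F' : Finset (Fin l.length)} (hF : D.IsF l F) (hs : F ⊆ F')
    (hr : D.Red (D.subwordF l F')) : D.Red (D.subwordF l (F' \ F) ++ D.subwordF l F) := by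
  unfold Red at *
  rw [wordProd_append, ← D.sub_split l hF hs, hr, List.length_append, subwordF_length,
    subwordF_length, subwordF_length, Finset.card_sdiff_add_card_eq_card hs]

theorem red_split (l : List D.I) (hr : D.Red l) {F : Finset (Fin l.length)} (hF : D.IsF l F) :
    D.Red (D.subwordF l Fᶜ ++ D.subwordF l F) := by
  have := D.red_sub_aux l hF (Finset.subset_univ F) (by rw [subwordF_univ]; exact hr)
  rwa [← Finset.compl_eq_univ_sdiff] at this

theorem prod_split_univ (l : List D.I) {F : Finset (Fin l.length)} (hF : D.IsF l F) :
    D.wordProd (D.subwordF l Fᶜ ++ D.subwordF l F) = D.wordProd l := by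
  have := D.sub_split l hF (Finset.subset_univ F)
  rw [subwordF_univ, ← Finset.compl_eq_univ_sdiff] at this
  rw [wordProd_append, this]

theorem red_sub (l : List D.I) (hr : D.Red l) {F : Finset (Fin l.length)} (hF : D.IsF l F) :
    D.Red (D.subwordF l F) := (D.red_append (D.red_split l hr hF)).2

theorem red_sub' (l : List D.I) (hr : D.Red l) {F F' : Finset (Fin l.length)} (hF : D.IsF l F)
    (hF' : D.IsF l F') (hs : F ⊆ F') :
    D.Red (D.subwordF l (F' \ F) ++ D.subwordF l F) :=
  D.red_sub_aux l hF hs (D.red_sub l hr hF')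

theorem bruhat_of_subset (l : List D.I) (hr : D.Red l) {F F' : Finset (Fin l.length)}
    (hF : D.IsF l F) (hF' : D.IsF l F') (hs : F ⊆ F') :
    D.bruhatLE (D.wordProd (D.subwordF l F)) (D.wordProd (D.subwordF l F')) := by
  have := D.weak_bruhat _ _ (D.red_sub' l hr hF hF' hs)
  rwa [wordProd_append, ← D.sub_split l hF hs] at this

theorem minu_split (l : List D.I) (hr : D.Red l) {x : D.V} (hm : D.Minu x l)
    {F : Finset (Fin l.length)} (hF : D.IsF l F) :
    D.Minu x (D.subwordF l Fᶜ ++ D.subwordF l F) :=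
  D.minu_of_minu hm (D.prod_split_univ l hF) (D.red_split l hr hF)

theorem minu_sub (l : List D.I) (hr : D.Red l) {x : D.V} (hm : D.Minu x l)
    {F : Finset (Fin l.length)} (hF : D.IsF l F) : D.Minu x (D.subwordF l F) :=
  (D.minu_append (D.minu_split l hr hm hF)).1

/-- minimal representatives pass to final factors -/
theorem minRep_right {H : Subgroup D.W} {a b : D.W} (h : D.IsMinRep H (a * b))
    (hl : D.length (a * b) = D.length a + D.length b) : D.IsMinRep H b := by
  intro g hg
  have h1 := h (a * g) (by
    rw [show (a * b)⁻¹ * (a * g) = b⁻¹ * g by group]; exact hg)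
  have := D.length_mul_le a g
  omega

theorem minRep_sub {H : Subgroup D.W} (l : List D.I) (hr : D.Red l)
    (h : D.IsMinRep H (D.wordProd l))
    {F : Finset (Fin l.length)} (hF : D.IsF l F) : D.IsMinRep H (D.wordProd (D.subwordF l F)) := by
  have e := D.prod_split_univ l hF
  have h1 := D.red_split l hr hF
  have h2 := D.red_append h1
  rw [wordProd_append] at e
  refine D.minRep_right (e ▸ h) ?_
  unfold Red at h1 h2
  rw [← wordProd_append, h1, h2.1, h2.2, List.length_append]

end WeylSetting

namespace WeylSetting

variable (D : WeylSetting)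

theorem coroot_s_comm {i a : D.I} (hai : a ≠ i) (h : D.Comm i a) (x : D.V) :
    D.coroot (D.simple i) (D.act (D.s a) x) = D.coroot (D.simple i) x := by
  rw [s_apply, map_sub, map_smul, D.comm_coroot hai h]; simp

theorem coroot_s_self (i : D.I) (x : D.V) :
    D.coroot (D.simple i) (D.act (D.s i) x) = - D.coroot (D.simple i) x := by
  rw [s_apply, map_sub, map_smul, D.coroot_self _ (D.simple_mem i), smul_eq_mul]; ring

/-- the pairing cannot be `1` above a visible letter of colour `i` -/
theorem pairing_neg {x : D.V} (i : D.I) (l : List D.I) (hm : D.Minu x l) (k : Fin l.length)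
    (hk : l.get k = i) (hc : ∀ m, m < k → D.Comm i (l.get m)) :
    D.coroot (D.simple i) (D.act (D.wordProd l) x) = -1 := by
  induction l with
  | nil => exact k.elim0
  | cons a l ih =>
    rw [wordProd_cons, act_mul]
    induction k using Fin.cases with
    | zero =>
      have : a = i := hk
      subst this
      rw [coroot_s_self, hm.1]
    | succ k =>
      have h1 := ih hm.2 k hk fun m hmk => hc m.succ (Fin.succ_lt_succ_iff.mpr hmk)
      have h2 : D.Comm i a := hc 0 (Fin.succ_pos k)
      by_cases ha : a = i
      · subst ha
        have := hm.1
        rw [h1] at this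
        norm_num at this
      · rw [D.coroot_s_comm ha h2, h1]

theorem exists_between {x : D.V} (l : List D.I) (hm : D.Minu x l) (j k : Fin l.length)
    (hjk : j < k) (e : l.get j = l.get k) :
    ∃ m, j < m ∧ m < k ∧ ¬ D.Comm (l.get j) (l.get m) := by
  induction l with
  | nil => exact k.elim0
  | cons a l ih =>
    induction k using Fin.cases with
    | zero => exact absurd hjk (Fin.not_lt_zero j)
    | succ k =>
      induction j using Fin.cases with
      | zero =>
        by_contra hcon
        push Not at hcon
        have h1 := D.pairing_neg a l hm.2 k e.symm fun m hmk =>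
          hcon m.succ (Fin.succ_pos m) (Fin.succ_lt_succ_iff.mpr hmk)
        have := hm.1
        rw [h1] at this
        norm_num at this
      | succ j =>
        obtain ⟨m, h1, h2, h3⟩ := ih hm.2 j k (Fin.succ_lt_succ_iff.mp hjk) e
        exact ⟨m.succ, Fin.succ_lt_succ_iff.mpr h1, Fin.succ_lt_succ_iff.mpr h2, h3⟩

theorem isF_color {x : D.V} (l : List D.I) (hm : D.Minu x l) {F : Finset (Fin l.length)}
    (hF : D.IsF l F) {j k : Fin l.length} (hjk : j < k) (e : l.get j = l.get k) (hj : j ∈ F) :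
    k ∈ F := by
  obtain ⟨m, h1, h2, h3⟩ := D.exists_between l hm j k hjk e
  refine hF m k h2 (hF j m h1 hj h3) fun hc => h3 ?_
  rw [e]; exact hc.symm

theorem subset_of_count {x : D.V} (l : List D.I) (hm : D.Minu x l) {F F' : Finset (Fin l.length)}
    (hF : D.IsF l F) (hF' : D.IsF l F')
    (hc : ∀ i, (D.subwordF l F).count i ≤ (D.subwordF l F').count i) : F ⊆ F' := by
  intro p hp
  by_contra hp'
  have h := hc (l.get p)
  rw [subwordF_count, subwordF_count] at h
  refine absurd h (not_le.mpr (Finset.card_lt_card ?_))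
  rw [Finset.ssubset_iff_of_subset]
  · exact ⟨p, by simp [hp], by simp [hp']⟩
  · intro q hq
    rw [Finset.mem_filter] at hq ⊢
    refine ⟨?_, hq.2⟩
    rcases lt_trichotomy p q with h1 | h1 | h1
    · exact D.isF_color l hm hF h1 hq.2.symm hp
    · exact h1 ▸ hp
    · exact absurd (D.isF_color l hm hF' h1 hq.2 hq.1) hp'


theorem pos_cons_map (i : D.I) (l : List D.I) (F : Finset (Fin l.length)) :
    D.subwordF (i :: l) (F.map (Fin.succEmb l.length)) = D.subwordF l F := by
  unfold subwordF
  rw [show List.finRange (i :: l).length = 0 :: (List.finRange l.length).map Fin.succ from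
    List.finRange_succ]
  rw [List.filter_cons_of_neg (by simp [Fin.succ_ne_zero]), List.filter_map, List.map_map]
  refine congrArg (List.map l.get) (List.filter_congr fun j _ => ?_)
  simp

theorem pos_cons_insert (i : D.I) (l : List D.I) (F : Finset (Fin l.length)) :
    D.subwordF (i :: l) (insert 0 (F.map (Fin.succEmb l.length))) = i :: D.subwordF l F := by
  unfold subwordF
  rw [show List.finRange (i :: l).length = 0 :: (List.finRange l.length).map Fin.succ from
    List.finRange_succ]
  rw [List.filter_cons_of_pos (by simp), List.filter_map, List.map_cons, List.map_map]
  refine congrArg (List.cons i) (congrArg (List.map l.get) (List.filter_congr fun j _ => ?_))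
  simp [Fin.succ_ne_zero]

theorem isF_map (i : D.I) (l : List D.I) {F : Finset (Fin l.length)} (hF : D.IsF l F) :
    D.IsF (i :: l) (F.map (Fin.succEmb l.length)) := by
  intro j k hjk hj hc
  rw [Finset.mem_map] at hj
  obtain ⟨j, hj, rfl⟩ := hj
  induction k using Fin.cases with
  | zero => exact absurd hjk (Fin.not_lt_zero _)
  | succ k =>
    exact Finset.mem_map_of_mem _ (hF j k (Fin.succ_lt_succ_iff.mp hjk) hj hc)

theorem isF_insert (i : D.I) (l : List D.I) {F : Finset (Fin l.length)} (hF : D.IsF l F)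
    (h : ∀ q, q ∉ F → D.Comm i (l.get q)) :
    D.IsF (i :: l) (insert 0 (F.map (Fin.succEmb l.length))) := by
  intro j k hjk hj hc
  rw [Finset.mem_insert] at hj ⊢
  rcases hj with rfl | hj
  · right
    induction k using Fin.cases with
    | zero => exact absurd hjk (Fin.not_lt_zero _)
    | succ k =>
      refine Finset.mem_map_of_mem _ ?_
      by_contra hk
      exact hc (h k hk)
  · exact Or.inr (D.isF_map i l hF j k hjk hj hc)

/-- trichotomy for the pairing with `α_i` along a minuscule word -/
theorem pairing_tri {α : Type} (c : α → D.I) (i : D.I) (x : D.V)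
    (hx : 1 ≤ D.coroot (D.simple i) x) (L : List α) (hm : D.Minu x (L.map c)) :
    ((∀ q ∈ L, D.Comm i (c q)) ∧
      1 ≤ D.coroot (D.simple i) (D.act (D.wordProd (L.map c)) x)) ∨
    (∃ a p b, L = a ++ p :: b ∧ c p = i ∧ ∀ q ∈ b, D.Comm i (c q)) ∨
    2 ≤ D.coroot (D.simple i) (D.act (D.wordProd (L.map c)) x) := by
  induction L with
  | nil => left; simpa [wordProd_nil, act_one] using hx
  | cons p L ih =>
    rw [List.map_cons] at hm ⊢
    rw [wordProd_cons, act_mul]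
    have hnc : ¬ D.Comm i (c p) → ∀ y : D.V, D.coroot (D.simple (c p)) y = 1 →
        D.coroot (D.simple i) y + 1 ≤ D.coroot (D.simple i) (D.act (D.s (c p)) y) := by
      intro h y hy
      have := D.noncomm_coroot h
      rw [s_apply, hy, one_smul, map_sub]
      linarith
    rcases ih hm.2 with ⟨h1, h2⟩ | ⟨a, q, b, h1, h2, h3⟩ | h
    · by_cases hp : c p = i
      · exact Or.inr (Or.inl ⟨[], p, L, rfl, hp, h1⟩)
      · by_cases hcm : D.Comm i (c p)
        · left
          refine ⟨?_, by rw [D.coroot_s_comm hp hcm]; exact h2⟩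
          intro q hq
          rcases List.mem_cons.mp hq with rfl | hq
          · exact hcm
          · exact h1 q hq
        · right; right
          have := hnc hcm _ hm.1
          linarith
    · exact Or.inr (Or.inl ⟨p :: a, q, b, by rw [h1]; rfl, h2, h3⟩)
    · right; right
      by_cases hp : c p = i
      · have := hm.1
        rw [hp] at this
        linarith
      · by_cases hcm : D.Comm i (c p)
        · rw [D.coroot_s_comm hp hcm]; exact h
        · have := hnc hcm _ hm.1
          linarith

theorem pos_singleton (l : List D.I) (p : Fin l.length) : D.subwordF l {p} = [l.get p] := by
  have h : D.pos l {p} = [p] := by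
    have h1 := D.pos_length l {p}
    rw [Finset.card_singleton, List.length_eq_one_iff] at h1
    obtain ⟨q, hq⟩ := h1
    have := D.mem_pos l {p} p
    rw [hq] at this ⊢
    simp at this
    rw [this]
  rw [subwordF_eq, h]; rfl

/-- main existence result -/
theorem exists_filter {pi : D.V} (hpi : D.IsDominant pi) (l : List D.I) (hr : D.Red l)
    (hm : D.Minu pi l) : ∀ z, D.IsMinRep (D.stab pi) z → ∀ m : List D.I, m.Sublist l →
      D.wordProd m = z → ∃ F, D.IsF l F ∧ D.wordProd (D.subwordF l F) = z := by
  induction l with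
  | nil =>
    intro z _ m hsub e
    rw [List.sublist_nil] at hsub
    subst hsub
    exact ⟨∅, fun j => j.elim0, by simpa [subwordF] using e⟩
  | cons i l ih =>
    have hr' := D.red_tail hr
    have ih := ih hr' hm.2
    have lift : ∀ z, (∃ F, D.IsF l F ∧ D.wordProd (D.subwordF l F) = z) →
        ∃ F, D.IsF (i :: l) F ∧ D.wordProd (D.subwordF (i :: l) F) = z := by
      rintro z ⟨F, h1, h2⟩
      exact ⟨_, D.isF_map i l h1, by rw [pos_cons_map, h2]⟩
    intro z hz m hsub e
    rcases List.sublist_cons_iff.mp hsub with h | ⟨m', rfl, h⟩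
    · exact lift z (ih z hz m h e)
    · rw [wordProd_cons] at e
      rcases D.pos_or_neg (D.roots_invariant (D.wordProd m')⁻¹ _ (D.simple_mem i)) with hp | hp
      · have hlt : D.length (D.wordProd m') < D.length (D.s i * D.wordProd m') :=
          D.length_lt_of_pos (D.simple_pos i) _ hp
        have hle := D.length_s_mul_le i (D.wordProd m')
        have hz' : D.IsMinRep (D.stab pi) (D.wordProd m') := by
          subst e
          refine D.minRep_right hz ?_
          have h2 := D.length_le [i]
          rw [wordProd_cons, wordProd_nil, mul_one] at h2
          have h3 := D.length_mul_le (D.s i) (D.wordProd m')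
          simp at h2
          omega
        obtain ⟨F, hF, eF⟩ := ih _ hz' m' h rfl
        have hc0 : 1 ≤ D.coroot (D.simple i) (D.act (D.wordProd m') pi) := by
          have h1 := D.coroot_dominant hpi hp
          obtain ⟨n, hn⟩ := hpi.1 _ hp
          have h2 := D.coroot_equivariant (D.wordProd m') _ hp.1 pi
          rw [act_act_inv] at h2
          rw [h2]
          have h3 : D.coroot (D.act (D.wordProd m')⁻¹ (D.simple i)) pi ≠ 0 := by
            intro h0
            rw [h0] at h2
            have h4 := hz (D.wordProd m') (by
              change D.act (z⁻¹ * D.wordProd m') pi = pi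
              rw [← e, mul_inv_rev, s_inv, act_mul, act_mul, s_apply, h2, zero_smul, sub_zero,
                act_inv_act])
            rw [← e] at h4
            omega
          rw [hn] at h1 h3 ⊢
          have a1 : 0 ≤ n := by exact_mod_cast h1
          have a2 : n ≠ 0 := by exact_mod_cast h3
          have : 1 ≤ n := by omega
          exact_mod_cast this
        have hms := (D.minu_append (D.minu_split l hr' hm.2 hF)).2
        have h1 := hm.1
        rw [← D.prod_split_univ l hF, wordProd_append, act_mul] at h1
        rw [eF] at hms h1
        rw [subwordF_eq] at hms h1
        rcases D.pairing_tri l.get i _ hc0 _ hms with ⟨h2, _⟩ | ⟨a, p, b, hL, hpi', hb⟩ | h2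
        · refine ⟨_, D.isF_insert i l hF (fun q hq => h2 q ?_), ?_⟩
          · rw [mem_pos]; simpa using hq
          · rw [pos_cons_insert, wordProd_cons, eF, e]
        · apply lift
          have hpF : p ∉ F := by
            have : p ∈ D.pos l Fᶜ := by rw [hL]; simp
            rw [mem_pos] at this
            simpa using this
          have hlater : ∀ q, p < q → q ∉ F → D.Comm i (l.get q) := by
            intro q hpq hq
            have h3 : q ∈ D.pos l Fᶜ := by rw [mem_pos]; simpa using hq
            have h4 := D.pos_sorted l Fᶜ
            rw [hL] at h3 h4
            rw [List.pairwise_append] at h4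
            rcases List.mem_append.mp h3 with h5 | h5
            · exact absurd (h4.2.2 q h5 p (by simp)) (not_lt.mpr hpq.le)
            · rcases List.mem_cons.mp h5 with h5 | h5
              · exact absurd h5 hpq.ne'
              · exact hb q h5
          refine ⟨insert p F, ?_, ?_⟩
          · intro j k hjk hj hc
            rw [Finset.mem_insert] at hj ⊢
            right
            rcases hj with rfl | hj
            · by_contra hk
              exact hc (by rw [hpi']; exact hlater k hjk hk)
            · exact hF j k hjk hj hc
          · rw [D.sub_split l hF (Finset.subset_insert p F), eF, ← e]
            have : insert p F \ F = {p} := by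
              ext q; simp only [Finset.mem_sdiff, Finset.mem_insert, Finset.mem_singleton]
              constructor
              · rintro ⟨h1 | h1, h2⟩
                · exact h1
                · exact absurd h1 h2
              · rintro rfl; exact ⟨Or.inl rfl, hpF⟩
            rw [this, pos_singleton, wordProd_cons, wordProd_nil, mul_one, hpi']
        · linarith
      · obtain ⟨m'', h1, _, h3⟩ := D.exchange m' _ (D.simple_pos i) hp
        exact lift z (ih z hz m'' (h1.trans h) (h3.trans e))

theorem subset_of_bruhat {pi : D.V} (hpi : D.IsDominant pi) (l : List D.I) (hr : D.Red l)
    (hm : D.Minu pi l) (hmin : D.IsMinRep (D.stab pi) (D.wordProd l))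
    {F F' : Finset (Fin l.length)} (hF : D.IsF l F) (hF' : D.IsF l F')
    (h : D.bruhatLE (D.wordProd (D.subwordF l F)) (D.wordProd (D.subwordF l F'))) : F ⊆ F' := by
  obtain ⟨m, h1, h2⟩ := D.bruhat_sublist h _ rfl
  have hr' := D.red_sub l hr hF'
  have hm' := D.minu_sub l hr hm hF'
  obtain ⟨F'', h3, h4⟩ := D.exists_filter hpi _ hr' hm' _ (D.minRep_sub l hr hmin hF) m h1 h2
  refine D.subset_of_count l hm hF hF' fun i => ?_
  rw [D.minu_count (D.minu_sub l hr hm hF) (D.minu_sub _ hr' hm' h3) h4.symm i]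
  apply List.Sublist.count_le
  conv_rhs => rw [← D.subwordF_univ (D.subwordF l F')]
  rw [subwordF_univ]
  rw [subwordF_eq]
  conv_rhs => rw [← List.map_get_finRange (D.subwordF l F')]
  exact List.Sublist.map _ List.filter_sublist

theorem filter_unique {pi : D.V} (l : List D.I) (hr : D.Red l)
    (hm : D.Minu pi l) {F F' : Finset (Fin l.length)} (hF : D.IsF l F) (hF' : D.IsF l F')
    (h : D.wordProd (D.subwordF l F) = D.wordProd (D.subwordF l F')) : F = F' := by
  have hc := D.minu_count (D.minu_sub l hr hm hF) (D.minu_sub l hr hm hF') h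
  exact Finset.Subset.antisymm (D.subset_of_count l hm hF hF' fun i => (hc i).le)
    (D.subset_of_count l hm hF' hF fun i => (hc i).ge)

theorem heap_equiv (l : List D.I) (S : Finset (Fin l.length))
    (hS : ∀ j k, k ∈ S → D.heapLE l j k → j ∈ S) :
    ∃ e : {j : Fin l.length // j ∈ S} ≃ Fin (D.subwordF l S).length,
      (∀ j, (D.subwordF l S).get (e j) = l.get j.val) ∧
      ∀ j k, D.heapLE l j.val k.val ↔ D.heapLE (D.subwordF l S) (e j) (e k) := by
  have hn : (D.pos l S).Nodup := (List.nodup_finRange _).filter _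
  have hlen : (D.pos l S).length = (D.subwordF l S).length := by
    rw [subwordF_eq, List.length_map]
  let e : {j : Fin l.length // j ∈ S} ≃ Fin (D.subwordF l S).length :=
    (Equiv.subtypeEquivRight fun j => (D.mem_pos l S j).symm).trans
      ((List.Nodup.getEquiv _ hn).symm.trans (finCongr hlen))
  have hget : ∀ a, (e.symm a).val = (D.pos l S).get (Fin.cast hlen.symm a) := fun a => rfl
  have hcol : ∀ j, (D.subwordF l S).get (e j) = l.get j.val := by
    intro j
    obtain ⟨a, rfl⟩ := e.symm.surjective j
    rw [Equiv.apply_symm_apply, hget]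
    simp [subwordF_eq]
  have hmono : ∀ j k, e j < e k ↔ j.val < k.val := by
    intro j k
    obtain ⟨a, rfl⟩ := e.symm.surjective j
    obtain ⟨b, rfl⟩ := e.symm.surjective k
    rw [Equiv.apply_symm_apply, Equiv.apply_symm_apply, hget, hget]
    have hsm : StrictMono (D.pos l S).get := fun x y hxy =>
      (List.pairwise_iff_get.mp (D.pos_sorted l S)) x y hxy
    rw [hsm.lt_iff_lt]; rfl
  have hcov : ∀ j k, D.heapCovers l j.val k.val ↔ D.heapCovers (D.subwordF l S) (e j) (e k) := by
    intro j k
    unfold heapCovers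
    rw [hcol, hcol]
    exact and_congr (hmono j k).symm Iff.rfl
  refine ⟨e, hcol, fun j k => ⟨?_, ?_⟩⟩
  · obtain ⟨j, hj⟩ := j
    obtain ⟨k, hk⟩ := k
    intro h
    dsimp only at h
    change Relation.ReflTransGen _ j k at h
    induction h with
    | refl => exact Relation.ReflTransGen.refl
    | @tail b c _ hbc ih =>
      have hb := hS b c hk (Relation.ReflTransGen.single hbc)
      exact (ih hb).tail ((hcov ⟨b, hb⟩ ⟨c, hk⟩).mp hbc)
  · intro h
    have key : ∀ a b, Relation.ReflTransGen (D.heapCovers (D.subwordF l S)) a b →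
        D.heapLE l (e.symm a).val (e.symm b).val := by
      intro a b hab
      induction hab with
      | refl => exact Relation.ReflTransGen.refl
      | @tail b c _ hbc ih =>
        refine ih.tail ((hcov _ _).mpr ?_)
        rwa [Equiv.apply_symm_apply, Equiv.apply_symm_apply]
    simpa using key _ _ h

end WeylSetting

/-- For `π`-minuscule `v ≤ w` in `W^π` and a reduced word `l` of `w`:
`H(v)` is canonically identified with an order filter `Fv` of `H(w)` (existing
and unique); the complement `H(w) ∖ H(v)` is (the heap of) a reduced word of
`w v⁻¹`, compatibly with the heap orders; and `z ↦ H(z) ∖ H(v)` is a poset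
isomorphism from the Bruhat interval `[v,w]^π` onto the poset of order filters
of `H(w) ∖ H(v)` ordered by inclusion (stated here via its inverse
`G ↦ wordProd(G ∪ Fv)`). -/
theorem interval_iso_filters
    (D : WeylSetting) (pi : D.V) (hpi : D.IsDominant pi)
    (v w : D.W) (hv : D.IsMinuscule pi v) (hw : D.IsMinuscule pi w)
    (hvr : D.IsMinRep (D.stab pi) v) (hwr : D.IsMinRep (D.stab pi) w)
    (hvw : D.bruhatLE v w)
    (l : List D.I) (hl : D.IsReduced l w) :
    (∃! Fv : Finset (Fin l.length),
        D.IsHeapFilter l Fv ∧ D.wordProd (D.subwordF l Fv) = v ∧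
          Fv.card = D.length v) ∧
    (∀ Fv : Finset (Fin l.length),
      D.IsHeapFilter l Fv → D.wordProd (D.subwordF l Fv) = v →
      Fv.card = D.length v →
        (D.IsReduced (D.subwordF l Fvᶜ) (w * v⁻¹)) ∧
        (∃ e : {j : Fin l.length // j ∈ Fvᶜ} ≃ Fin (D.subwordF l Fvᶜ).length,
          (∀ j, (D.subwordF l Fvᶜ).get (e j) = l.get j.val) ∧
          ∀ j k, D.heapLE l j.val k.val ↔
            D.heapLE (D.subwordF l Fvᶜ) (e j) (e k)) ∧
        (∀ G : Finset (Fin l.length), G ⊆ Fvᶜ →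
          (∀ j k, j ∈ G → k ∈ Fvᶜ → D.heapLE l j k → k ∈ G) →
            (D.IsMinRep (D.stab pi) (D.wordProd (D.subwordF l (G ∪ Fv))) ∧
             D.bruhatLE v (D.wordProd (D.subwordF l (G ∪ Fv))) ∧
             D.bruhatLE (D.wordProd (D.subwordF l (G ∪ Fv))) w)) ∧
        (∀ z : D.W, D.IsMinRep (D.stab pi) z → D.bruhatLE v z → D.bruhatLE z w →
          ∃! G : Finset (Fin l.length), G ⊆ Fvᶜ ∧
            (∀ j k, j ∈ G → k ∈ Fvᶜ → D.heapLE l j k → k ∈ G) ∧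
            D.wordProd (D.subwordF l (G ∪ Fv)) = z) ∧
        (∀ G G' : Finset (Fin l.length), G ⊆ Fvᶜ → G' ⊆ Fvᶜ →
          (∀ j k, j ∈ G → k ∈ Fvᶜ → D.heapLE l j k → k ∈ G) →
          (∀ j k, j ∈ G' → k ∈ Fvᶜ → D.heapLE l j k → k ∈ G') →
            (G ⊆ G' ↔
              D.bruhatLE (D.wordProd (D.subwordF l (G ∪ Fv)))
                (D.wordProd (D.subwordF l (G' ∪ Fv)))))) := by
  obtain ⟨rfl, hlen⟩ := hl
  have hr : D.Red l := hlen.symm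
  have hm : D.Minu pi l := by
    obtain ⟨l0, h0, h1⟩ := hw
    exact D.minu_of_minu (D.minu_of pi l0 h1) h0.1.symm hr
  have hex : ∀ z, D.IsMinRep (D.stab pi) z → D.bruhatLE z (D.wordProd l) →
      ∃ F, D.IsF l F ∧ D.wordProd (D.subwordF l F) = z := by
    intro z hz hzw
    obtain ⟨m, h1, h2⟩ := D.bruhat_sublist hzw l rfl
    exact D.exists_filter hpi l hr hm z hz m h1 h2
  refine ⟨?_, ?_⟩
  · obtain ⟨F, hF, e⟩ := hex v hvr hvw
    refine ⟨F, ⟨(D.isF_iff l F).mpr hF, e, ?_⟩, ?_⟩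
    · have := D.red_sub l hr hF
      unfold WeylSetting.Red at this
      rw [e, D.subwordF_length] at this
      exact this.symm
    · rintro F' ⟨h1, h2, _⟩
      exact D.filter_unique l hr hm ((D.isF_iff l F').mp h1) hF (h2.trans e.symm)
  · intro Fv hFv0 ev hcard
    have hFv := (D.isF_iff l Fv).mp hFv0
    have hunion : ∀ G : Finset (Fin l.length),
        (∀ j k, j ∈ G → k ∈ Fvᶜ → D.heapLE l j k → k ∈ G) → D.IsF l (G ∪ Fv) := by
      intro G hG
      rw [← D.isF_iff]
      intro j k hj hjk
      rw [Finset.mem_union] at hj ⊢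
      by_cases hk : k ∈ Fv
      · exact Or.inr hk
      · rcases hj with hj | hj
        · exact Or.inl (hG j k hj (by simpa using hk) hjk)
        · exact Or.inr (hFv0 j k hj hjk)
    refine ⟨⟨?_, ?_⟩, ?_, ?_, ?_, ?_⟩
    · have h1 := D.prod_split_univ l hFv
      rw [D.wordProd_append, ev] at h1
      rw [← h1]; group
    · have h1 := D.prod_split_univ l hFv
      rw [D.wordProd_append, ev] at h1
      have h2 := (D.red_append (D.red_split l hr hFv)).1
      unfold WeylSetting.Red at h2
      rw [← h2, ← h1]; congr 1; group
    · refine D.heap_equiv l Fvᶜ fun j k hk hjk => ?_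
      rw [Finset.mem_compl] at hk ⊢
      exact fun hj => hk (hFv0 j k hj hjk)
    · intro G hGs hG
      have hF := hunion G hG
      refine ⟨D.minRep_sub l hr hwr hF, ?_, ?_⟩
      · have := D.bruhat_of_subset l hr hFv hF Finset.subset_union_right
        rwa [ev] at this
      · have := D.bruhat_of_subset l hr hF (F' := Finset.univ)
          (fun _ _ _ _ _ => Finset.mem_univ _) (Finset.subset_univ _)
        rwa [D.subwordF_univ] at this
    · intro z hz hvz hzw
      obtain ⟨F, hF, e⟩ := hex z hz hzw
      have hsub : Fv ⊆ F := D.subset_of_bruhat hpi l hr hm hwr hFv hF (by rw [ev, e]; exact hvz)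
      refine ⟨F \ Fv, ⟨?_, ?_, ?_⟩, ?_⟩
      · intro j hj
        rw [Finset.mem_sdiff] at hj
        exact Finset.mem_compl.mpr hj.2
      · intro j k hj hk hjk
        rw [Finset.mem_sdiff] at hj ⊢
        exact ⟨(D.isF_iff l F).mpr hF j k hj.1 hjk, Finset.mem_compl.mp hk⟩
      · rw [Finset.sdiff_union_of_subset hsub, e]
      · rintro G ⟨h1, h2, h3⟩
        have h4 := D.filter_unique l hr hm (hunion G h2) hF (h3.trans e.symm)
        rw [← h4]
        ext j
        have h5 : j ∈ G → j ∉ Fv := fun hj => Finset.mem_compl.mp (h1 hj)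
        simp only [Finset.mem_sdiff, Finset.mem_union]
        tauto
    · intro G G' hGs hGs' hG hG'
      have hF := hunion G hG
      have hF' := hunion G' hG'
      constructor
      · intro h
        exact D.bruhat_of_subset l hr hF hF' (Finset.union_subset_union_left h)
      · intro h j hj
        have h1 := D.subset_of_bruhat hpi l hr hm hwr hF hF' h (Finset.mem_union_left _ hj)
        rcases Finset.mem_union.mp h1 with h2 | h2
        · exact h2
        · exact absurd h2 (Finset.mem_compl.mp (hGs hj))
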